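/- Let 0 → C' → C → C'' → 0 be a short exact sequence of twisted complexes over ℝ: linear maps ι_n : C'^n → C^n and π_n : C^n → C''^n commuting with the maps δ and η of each complex, with ι_n injective, π_n surjective, and ker π_n = im ι_n for every n. Write H^{ev} and H^{odd} for the even and odd twisted cohomology of the completions of C', C, C''. Then the maps induced by ι and π fit into an exact six-term sequence: there exist ℝ-linear connecting homomorphisms ∂⁰ : H^{ev}(C'') → H^{odd}(C') and ∂¹ : H^{odd}(C'') → H^{ev}(C') such that the sequence H^{ev}(C') → H^{ev}(C) → H^{ev}(C'') →(∂⁰) H^{odd}(C') → H^{odd}(C) → H^{odd}(C'') →(∂¹) H^{ev}(C') is exact at each of the six terms. (The six-term exact sequence in twisted cohomology used throughout Sections 2 and 3 of the paper.) -/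

import Mathlib

namespace TwistedSES

/-- The twisted differential `D = δ + η` on the completion `Ĉ = ∏ n, C n`, as a linear map. -/
def Dlin (C : ℕ → Type) [∀ n, AddCommGroup (C n)] [∀ n, Module ℝ (C n)]
    (δ : ∀ n, C n →ₗ[ℝ] C (n + 1)) (η : ∀ n, C n →ₗ[ℝ] C (n + 3)) :
    (∀ n, C n) →ₗ[ℝ] (∀ n, C n) where
  toFun c := fun n =>
    match n with
    | 0 => 0
    | 1 => δ 0 (c 0)
    | 2 => δ 1 (c 1)
    | (m + 3) => δ (m + 2) (c (m + 2)) + η m (c m)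
  map_add' a b := by
    funext n
    match n with
    | 0 => simp
    | 1 => simp
    | 2 => simp
    | (m + 3) => simp; abel
  map_smul' r a := by
    funext n
    match n with
    | 0 => simp
    | 1 => simp
    | 2 => simp
    | (m + 3) => simp

/-- The even part of `Ĉ`: families supported in even degrees. -/
def evenSub (C : ℕ → Type) [∀ n, AddCommGroup (C n)] [∀ n, Module ℝ (C n)] :
    Submodule ℝ (∀ n, C n) where
  carrier := {c | ∀ n, Odd n → c n = 0}
  add_mem' := fun {a b} ha hb n hn => by
    simp only [Pi.add_apply, ha n hn, hb n hn, add_zero]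
  zero_mem' := fun n _ => rfl
  smul_mem' := fun r a ha n hn => by
    simp only [Pi.smul_apply, ha n hn, smul_zero]

/-- The odd part of `Ĉ`: families supported in odd degrees. -/
def oddSub (C : ℕ → Type) [∀ n, AddCommGroup (C n)] [∀ n, Module ℝ (C n)] :
    Submodule ℝ (∀ n, C n) where
  carrier := {c | ∀ n, Even n → c n = 0}
  add_mem' := fun {a b} ha hb n hn => by
    simp only [Pi.add_apply, ha n hn, hb n hn, add_zero]
  zero_mem' := fun n _ => rfl
  smul_mem' := fun r a ha n hn => by
    simp only [Pi.smul_apply, ha n hn, smul_zero]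

/-- Even twisted cocycles. -/
def Zev (C : ℕ → Type) [∀ n, AddCommGroup (C n)] [∀ n, Module ℝ (C n)]
    (δ : ∀ n, C n →ₗ[ℝ] C (n + 1)) (η : ∀ n, C n →ₗ[ℝ] C (n + 3)) :
    Submodule ℝ (∀ n, C n) :=
  evenSub C ⊓ LinearMap.ker (Dlin C δ η)

/-- Odd twisted cocycles. -/
def Zodd (C : ℕ → Type) [∀ n, AddCommGroup (C n)] [∀ n, Module ℝ (C n)]
    (δ : ∀ n, C n →ₗ[ℝ] C (n + 1)) (η : ∀ n, C n →ₗ[ℝ] C (n + 3)) :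
    Submodule ℝ (∀ n, C n) :=
  oddSub C ⊓ LinearMap.ker (Dlin C δ η)

/-- Even twisted coboundaries, as a submodule of the even twisted cocycles. -/
def Bev (C : ℕ → Type) [∀ n, AddCommGroup (C n)] [∀ n, Module ℝ (C n)]
    (δ : ∀ n, C n →ₗ[ℝ] C (n + 1)) (η : ∀ n, C n →ₗ[ℝ] C (n + 3)) :
    Submodule ℝ (Zev C δ η) :=
  ((oddSub C).map (Dlin C δ η)).comap (Zev C δ η).subtype

/-- Odd twisted coboundaries, as a submodule of the odd twisted cocycles. -/
def Bodd (C : ℕ → Type) [∀ n, AddCommGroup (C n)] [∀ n, Module ℝ (C n)]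
    (δ : ∀ n, C n →ₗ[ℝ] C (n + 1)) (η : ∀ n, C n →ₗ[ℝ] C (n + 3)) :
    Submodule ℝ (Zodd C δ η) :=
  ((evenSub C).map (Dlin C δ η)).comap (Zodd C δ η).subtype

/-- Even twisted cohomology `H^{ev}` of the completion. -/
abbrev Hev (C : ℕ → Type) [∀ n, AddCommGroup (C n)] [∀ n, Module ℝ (C n)]
    (δ : ∀ n, C n →ₗ[ℝ] C (n + 1)) (η : ∀ n, C n →ₗ[ℝ] C (n + 3)) :=
  Zev C δ η ⧸ Bev C δ η

/-- Odd twisted cohomology `H^{odd}` of the completion. -/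
abbrev Hodd (C : ℕ → Type) [∀ n, AddCommGroup (C n)] [∀ n, Module ℝ (C n)]
    (δ : ∀ n, C n →ₗ[ℝ] C (n + 1)) (η : ∀ n, C n →ₗ[ℝ] C (n + 3)) :=
  Zodd C δ η ⧸ Bodd C δ η

/-- The map `Ĉ → Ĉ'` induced by a degreewise family of linear maps. -/
def piMapL (C C' : ℕ → Type)
    [∀ n, AddCommGroup (C n)] [∀ n, Module ℝ (C n)]
    [∀ n, AddCommGroup (C' n)] [∀ n, Module ℝ (C' n)]
    (φ : ∀ n, C n →ₗ[ℝ] C' n) : (∀ n, C n) →ₗ[ℝ] (∀ n, C' n) where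
  toFun c := fun n => φ n (c n)
  map_add' a b := by funext n; simp
  map_smul' r a := by funext n; simp

theorem piMapL_comm (C C' : ℕ → Type)
    [∀ n, AddCommGroup (C n)] [∀ n, Module ℝ (C n)]
    [∀ n, AddCommGroup (C' n)] [∀ n, Module ℝ (C' n)]
    (δ : ∀ n, C n →ₗ[ℝ] C (n + 1)) (η : ∀ n, C n →ₗ[ℝ] C (n + 3))
    (δ' : ∀ n, C' n →ₗ[ℝ] C' (n + 1)) (η' : ∀ n, C' n →ₗ[ℝ] C' (n + 3))
    (φ : ∀ n, C n →ₗ[ℝ] C' n)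
    (h1 : ∀ n (x : C n), φ (n + 1) (δ n x) = δ' n (φ n x))
    (h3 : ∀ n (x : C n), φ (n + 3) (η n x) = η' n (φ n x))
    (c : ∀ n, C n) :
    Dlin C' δ' η' (piMapL C C' φ c) = piMapL C C' φ (Dlin C δ η c) := by
  funext n
  match n with
  | 0 => show (0 : C' 0) = φ 0 0; rw [map_zero]
  | 1 => show δ' 0 (φ 0 (c 0)) = φ 1 (δ 0 (c 0)); rw [h1]
  | 2 => show δ' 1 (φ 1 (c 1)) = φ 2 (δ 1 (c 1)); rw [h1]
  | (m + 3) =>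
    show δ' (m + 2) (φ (m + 2) (c (m + 2))) + η' m (φ m (c m))
      = φ (m + 3) (δ (m + 2) (c (m + 2)) + η m (c m))
    rw [map_add, h1, h3]

theorem restrict_mem_ev (C C' : ℕ → Type)
    [∀ n, AddCommGroup (C n)] [∀ n, Module ℝ (C n)]
    [∀ n, AddCommGroup (C' n)] [∀ n, Module ℝ (C' n)]
    (δ : ∀ n, C n →ₗ[ℝ] C (n + 1)) (η : ∀ n, C n →ₗ[ℝ] C (n + 3))
    (δ' : ∀ n, C' n →ₗ[ℝ] C' (n + 1)) (η' : ∀ n, C' n →ₗ[ℝ] C' (n + 3))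
    (φ : ∀ n, C n →ₗ[ℝ] C' n)
    (h1 : ∀ n (x : C n), φ (n + 1) (δ n x) = δ' n (φ n x))
    (h3 : ∀ n (x : C n), φ (n + 3) (η n x) = η' n (φ n x)) :
    ∀ x ∈ Zev C δ η, piMapL C C' φ x ∈ Zev C' δ' η' := by
  intro x hx
  obtain ⟨he, hk⟩ := Submodule.mem_inf.mp hx
  refine Submodule.mem_inf.mpr ⟨?_, ?_⟩
  · intro n hn
    show φ n (x n) = 0
    rw [he n hn, map_zero]
  · rw [LinearMap.mem_ker] at hk ⊢
    rw [piMapL_comm C C' δ η δ' η' φ h1 h3, hk, map_zero]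

theorem restrict_mem_odd (C C' : ℕ → Type)
    [∀ n, AddCommGroup (C n)] [∀ n, Module ℝ (C n)]
    [∀ n, AddCommGroup (C' n)] [∀ n, Module ℝ (C' n)]
    (δ : ∀ n, C n →ₗ[ℝ] C (n + 1)) (η : ∀ n, C n →ₗ[ℝ] C (n + 3))
    (δ' : ∀ n, C' n →ₗ[ℝ] C' (n + 1)) (η' : ∀ n, C' n →ₗ[ℝ] C' (n + 3))
    (φ : ∀ n, C n →ₗ[ℝ] C' n)
    (h1 : ∀ n (x : C n), φ (n + 1) (δ n x) = δ' n (φ n x))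
    (h3 : ∀ n (x : C n), φ (n + 3) (η n x) = η' n (φ n x)) :
    ∀ x ∈ Zodd C δ η, piMapL C C' φ x ∈ Zodd C' δ' η' := by
  intro x hx
  obtain ⟨he, hk⟩ := Submodule.mem_inf.mp hx
  refine Submodule.mem_inf.mpr ⟨?_, ?_⟩
  · intro n hn
    show φ n (x n) = 0
    rw [he n hn, map_zero]
  · rw [LinearMap.mem_ker] at hk ⊢
    rw [piMapL_comm C C' δ η δ' η' φ h1 h3, hk, map_zero]

/-- The map induced on even twisted cohomology by a degreewise chain map. -/
def inducedEv (C C' : ℕ → Type)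
    [∀ n, AddCommGroup (C n)] [∀ n, Module ℝ (C n)]
    [∀ n, AddCommGroup (C' n)] [∀ n, Module ℝ (C' n)]
    (δ : ∀ n, C n →ₗ[ℝ] C (n + 1)) (η : ∀ n, C n →ₗ[ℝ] C (n + 3))
    (δ' : ∀ n, C' n →ₗ[ℝ] C' (n + 1)) (η' : ∀ n, C' n →ₗ[ℝ] C' (n + 3))
    (φ : ∀ n, C n →ₗ[ℝ] C' n)
    (h1 : ∀ n (x : C n), φ (n + 1) (δ n x) = δ' n (φ n x))
    (h3 : ∀ n (x : C n), φ (n + 3) (η n x) = η' n (φ n x)) :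
    Hev C δ η →ₗ[ℝ] Hev C' δ' η' :=
  Submodule.mapQ (Bev C δ η) (Bev C' δ' η')
    ((piMapL C C' φ).restrict (restrict_mem_ev C C' δ η δ' η' φ h1 h3))
    (by
      rintro ⟨x, hx⟩ hmem
      have hx' : x ∈ (oddSub C).map (Dlin C δ η) := hmem
      obtain ⟨b, hb, hdb⟩ := hx'
      show piMapL C C' φ x ∈ (oddSub C').map (Dlin C' δ' η')
      refine ⟨piMapL C C' φ b, ?_, ?_⟩
      · intro n hn
        show φ n (b n) = 0
        rw [hb n hn, map_zero]
      · rw [piMapL_comm C C' δ η δ' η' φ h1 h3, hdb])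

/-- The map induced on odd twisted cohomology by a degreewise chain map. -/
def inducedOdd (C C' : ℕ → Type)
    [∀ n, AddCommGroup (C n)] [∀ n, Module ℝ (C n)]
    [∀ n, AddCommGroup (C' n)] [∀ n, Module ℝ (C' n)]
    (δ : ∀ n, C n →ₗ[ℝ] C (n + 1)) (η : ∀ n, C n →ₗ[ℝ] C (n + 3))
    (δ' : ∀ n, C' n →ₗ[ℝ] C' (n + 1)) (η' : ∀ n, C' n →ₗ[ℝ] C' (n + 3))
    (φ : ∀ n, C n →ₗ[ℝ] C' n)
    (h1 : ∀ n (x : C n), φ (n + 1) (δ n x) = δ' n (φ n x))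
    (h3 : ∀ n (x : C n), φ (n + 3) (η n x) = η' n (φ n x)) :
    Hodd C δ η →ₗ[ℝ] Hodd C' δ' η' :=
  Submodule.mapQ (Bodd C δ η) (Bodd C' δ' η')
    ((piMapL C C' φ).restrict (restrict_mem_odd C C' δ η δ' η' φ h1 h3))
    (by
      rintro ⟨x, hx⟩ hmem
      have hx' : x ∈ (evenSub C).map (Dlin C δ η) := hmem
      obtain ⟨b, hb, hdb⟩ := hx'
      show piMapL C C' φ x ∈ (evenSub C').map (Dlin C' δ' η')
      refine ⟨piMapL C C' φ b, ?_, ?_⟩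
      · intro n hn
        show φ n (b n) = 0
        rw [hb n hn, map_zero]
      · rw [piMapL_comm C C' δ η δ' η' φ h1 h3, hdb])


/-- The cohomology of a differential `D` on a two-part graded module, at the part `P`, where `Q` is
the other part. -/
abbrev Cohomology {K A : Type*} [Field K] [AddCommGroup A] [Module K A]
    (P Q : Submodule K A) (D : A →ₗ[K] A) :=
  ↥(P ⊓ LinearMap.ker D) ⧸ (Q.map D).comap (P ⊓ LinearMap.ker D).subtype

theorem Cohomology.mk_eq_mk_iff {K A : Type*} [Field K] [AddCommGroup A] [Module K A]
    {P Q : Submodule K A} {D : A →ₗ[K] A} {x y : A}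
    (hx : x ∈ P ⊓ LinearMap.ker D) (hy : y ∈ P ⊓ LinearMap.ker D) :
    (Submodule.Quotient.mk ⟨x, hx⟩ : Cohomology P Q D) = Submodule.Quotient.mk ⟨y, hy⟩ ↔
      ∃ b ∈ Q, D b = x - y := by
  rw [Submodule.Quotient.eq]
  rfl

theorem Cohomology.mk_eq_zero_iff {K A : Type*} [Field K] [AddCommGroup A] [Module K A]
    {P Q : Submodule K A} {D : A →ₗ[K] A} {x : A} (hx : x ∈ P ⊓ LinearMap.ker D) :
    (Submodule.Quotient.mk ⟨x, hx⟩ : Cohomology P Q D) = 0 ↔ ∃ b ∈ Q, D b = x := by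
  rw [Submodule.Quotient.mk_eq_zero]
  rfl

/-- A short exact sequence of differential modules `(P ⊕ Q, D)` compatible with the two parts, with
a linear section `s` of the surjection `p`, and a linear retraction `r` of the injection `i`. -/
structure IsSplitShortExact {K A' A A'' : Type*} [Field K]
    [AddCommGroup A'] [Module K A'] [AddCommGroup A] [Module K A] [AddCommGroup A''] [Module K A'']
    (P' Q' : Submodule K A') (P Q : Submodule K A) (P'' Q'' : Submodule K A'')
    (D' : A' →ₗ[K] A') (D : A →ₗ[K] A) (D'' : A'' →ₗ[K] A'')
    (i : A' →ₗ[K] A) (p : A →ₗ[K] A'') (s : A'' →ₗ[K] A) (r : A →ₗ[K] A') : Prop where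
  comm_i : ∀ y, D (i y) = i (D' y)
  comm_p : ∀ x, D'' (p x) = p (D x)
  exact : ∀ x, p x = 0 ↔ ∃ y, i y = x
  p_s : ∀ c, p (s c) = c
  r_i : ∀ y, r (i y) = y
  D_D : ∀ x, D (D x) = 0
  D_mem_Q : ∀ x ∈ P, D x ∈ Q
  D_mem_P : ∀ x ∈ Q, D x ∈ P
  i_mem_P : ∀ y, i y ∈ P ↔ y ∈ P'
  i_mem_Q : ∀ y, i y ∈ Q ↔ y ∈ Q'
  p_mem_P : ∀ x ∈ P, p x ∈ P''
  p_mem_Q : ∀ x ∈ Q, p x ∈ Q''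
  s_mem_P : ∀ c ∈ P'', s c ∈ P
  s_mem_Q : ∀ c ∈ Q'', s c ∈ Q

namespace IsSplitShortExact

variable {K A' A A'' : Type*} [Field K]
  [AddCommGroup A'] [Module K A'] [AddCommGroup A] [Module K A] [AddCommGroup A''] [Module K A'']
  {P' Q' : Submodule K A'} {P Q : Submodule K A} {P'' Q'' : Submodule K A''}
  {D' : A' →ₗ[K] A'} {D : A →ₗ[K] A} {D'' : A'' →ₗ[K] A''}
  {i : A' →ₗ[K] A} {p : A →ₗ[K] A''} {s : A'' →ₗ[K] A} {r : A →ₗ[K] A'}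

theorem swap (h : IsSplitShortExact P' Q' P Q P'' Q'' D' D D'' i p s r) :
    IsSplitShortExact Q' P' Q P Q'' P'' D' D D'' i p s r where
  comm_i := h.comm_i
  comm_p := h.comm_p
  exact := h.exact
  p_s := h.p_s
  r_i := h.r_i
  D_D := h.D_D
  D_mem_Q := h.D_mem_P
  D_mem_P := h.D_mem_Q
  i_mem_P := h.i_mem_Q
  i_mem_Q := h.i_mem_P
  p_mem_P := h.p_mem_Q
  p_mem_Q := h.p_mem_P
  s_mem_P := h.s_mem_Q
  s_mem_Q := h.s_mem_P

theorem injective (h : IsSplitShortExact P' Q' P Q P'' Q'' D' D D'' i p s r) :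
    Function.Injective i :=
  Function.LeftInverse.injective h.r_i

theorem p_i (h : IsSplitShortExact P' Q' P Q P'' Q'' D' D D'' i p s r) (y : A') :
    p (i y) = 0 :=
  (h.exact _).2 ⟨y, rfl⟩

theorem i_mem_cocycles (h : IsSplitShortExact P' Q' P Q P'' Q'' D' D D'' i p s r) {y : A'} :
    i y ∈ P ⊓ LinearMap.ker D ↔ y ∈ P' ⊓ LinearMap.ker D' := by
  rw [Submodule.mem_inf, Submodule.mem_inf, LinearMap.mem_ker, LinearMap.mem_ker, h.i_mem_P,
    h.comm_i, map_eq_zero_iff i h.injective]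

theorem p_mem_cocycles (h : IsSplitShortExact P' Q' P Q P'' Q'' D' D D'' i p s r) {x : A}
    (hx : x ∈ P ⊓ LinearMap.ker D) : p x ∈ P'' ⊓ LinearMap.ker D'' := by
  refine Submodule.mem_inf.2 ⟨h.p_mem_P x hx.1, ?_⟩
  rw [LinearMap.mem_ker, h.comm_p, LinearMap.mem_ker.1 hx.2, map_zero]

theorem exact_middle (h : IsSplitShortExact P' Q' P Q P'' Q'' D' D D'' i p s r)
    (f : Cohomology P' Q' D' →ₗ[K] Cohomology P Q D)
    (g : Cohomology P Q D →ₗ[K] Cohomology P'' Q'' D'')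
    (hf : ∀ y hy, f (Submodule.Quotient.mk ⟨y, hy⟩) =
      Submodule.Quotient.mk ⟨i y, h.i_mem_cocycles.2 hy⟩)
    (hg : ∀ x hx, g (Submodule.Quotient.mk ⟨x, hx⟩) =
      Submodule.Quotient.mk ⟨p x, h.p_mem_cocycles hx⟩) :
    Function.Exact f g := by
  intro z
  obtain ⟨⟨x, hx⟩, rfl⟩ := Submodule.Quotient.mk_surjective _ z
  rw [hg, Cohomology.mk_eq_zero_iff]
  constructor
  · rintro ⟨b, hb, hbx⟩
    obtain ⟨a, ha⟩ := (h.exact (x - D (s b))).1 <| by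
      rw [map_sub, ← h.comm_p, h.p_s, hbx, sub_self]
    have hDsb : D (s b) ∈ P ⊓ LinearMap.ker D := ⟨h.D_mem_P _ (h.s_mem_Q b hb), h.D_D _⟩
    have ha' : a ∈ P' ⊓ LinearMap.ker D' :=
      h.i_mem_cocycles.1 (ha ▸ Submodule.sub_mem _ hx hDsb)
    refine ⟨Submodule.Quotient.mk ⟨a, ha'⟩, ?_⟩
    rw [hf, eq_comm, Cohomology.mk_eq_mk_iff]
    exact ⟨s b, h.s_mem_Q b hb, by rw [ha, sub_sub_cancel]⟩
  · rintro ⟨w, hw⟩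
    obtain ⟨⟨a, ha⟩, rfl⟩ := Submodule.Quotient.mk_surjective _ w
    rw [hf, eq_comm, Cohomology.mk_eq_mk_iff] at hw
    obtain ⟨b, hb, hbx⟩ := hw
    exact ⟨p b, h.p_mem_Q b hb, by rw [h.comm_p, hbx, map_sub, h.p_i, sub_zero]⟩

theorem i_r_D_s (h : IsSplitShortExact P' Q' P Q P'' Q'' D' D D'' i p s r) {c : A''}
    (hc : D'' c = 0) : i (r (D (s c))) = D (s c) := by
  obtain ⟨y, hy⟩ := (h.exact (D (s c))).1 <| by rw [← h.comm_p, h.p_s, hc]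
  rw [← hy, h.r_i]

theorem r_D_s_mem_cocycles (h : IsSplitShortExact P' Q' P Q P'' Q'' D' D D'' i p s r) {c : A''}
    (hc : c ∈ P'' ⊓ LinearMap.ker D'') : r (D (s c)) ∈ Q' ⊓ LinearMap.ker D' := by
  rw [← h.swap.i_mem_cocycles, h.i_r_D_s hc.2]
  exact ⟨h.D_mem_Q _ (h.s_mem_P c hc.1), h.D_D _⟩

/-- The value of the zig-zag does not depend on the chosen lift, up to coboundaries. -/
theorem exists_D_eq_sub (h : IsSplitShortExact P' Q' P Q P'' Q'' D' D D'' i p s r)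
    {x : A} {y : A'} (hx : x ∈ P) (hxy : D x = i y) :
    ∃ a ∈ P', D' a = r (D (s (p x))) - y := by
  obtain ⟨a, ha⟩ := (h.exact (s (p x) - x)).1 <| by rw [map_sub, h.p_s, sub_self]
  refine ⟨a, (h.i_mem_P a).1 ?_, h.injective ?_⟩
  · rw [ha]
    exact Submodule.sub_mem _ (h.s_mem_P _ (h.p_mem_P x hx)) hx
  · rw [← h.comm_i, ha, map_sub, map_sub, hxy, h.i_r_D_s]
    rw [h.comm_p, hxy, h.p_i]

/-- The connecting homomorphism. -/
def connecting (h : IsSplitShortExact P' Q' P Q P'' Q'' D' D D'' i p s r) :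
    Cohomology P'' Q'' D'' →ₗ[K] Cohomology Q' P' D' :=
  Submodule.mapQ _ _ ((r ∘ₗ D ∘ₗ s).restrict fun _ hc => h.r_D_s_mem_cocycles hc) <| by
    rintro ⟨_, hc⟩ ⟨b, hb, rfl⟩
    obtain ⟨a, ha, hDa⟩ := h.exists_D_eq_sub (x := D (s b)) (y := 0)
      (h.D_mem_P _ (h.s_mem_Q b hb)) (by rw [h.D_D, map_zero])
    refine ⟨a, ha, ?_⟩
    rw [hDa, sub_zero, ← h.comm_p, h.p_s]
    rfl

theorem connecting_mk (h : IsSplitShortExact P' Q' P Q P'' Q'' D' D D'' i p s r) {c : A''}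
    (hc : c ∈ P'' ⊓ LinearMap.ker D'') :
    h.connecting (Submodule.Quotient.mk ⟨c, hc⟩) =
      Submodule.Quotient.mk ⟨r (D (s c)), h.r_D_s_mem_cocycles hc⟩ :=
  rfl

theorem exact_connecting_right (h : IsSplitShortExact P' Q' P Q P'' Q'' D' D D'' i p s r)
    (g : Cohomology P Q D →ₗ[K] Cohomology P'' Q'' D'')
    (hg : ∀ x hx, g (Submodule.Quotient.mk ⟨x, hx⟩) =
      Submodule.Quotient.mk ⟨p x, h.p_mem_cocycles hx⟩) :
    Function.Exact g h.connecting := by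
  intro z
  constructor
  · obtain ⟨⟨c, hc⟩, rfl⟩ := Submodule.Quotient.mk_surjective _ z
    rw [connecting_mk, Cohomology.mk_eq_zero_iff]
    rintro ⟨a, ha, hDa⟩
    have hx : s c - i a ∈ P ⊓ LinearMap.ker D := by
      refine Submodule.mem_inf.2 ⟨Submodule.sub_mem _ (h.s_mem_P c hc.1) ((h.i_mem_P a).2 ha), ?_⟩
      rw [LinearMap.mem_ker, map_sub, h.comm_i, hDa, h.i_r_D_s hc.2, sub_self]
    refine ⟨Submodule.Quotient.mk ⟨s c - i a, hx⟩, ?_⟩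
    rw [hg]
    congr 2
    rw [map_sub, h.p_s, h.p_i, sub_zero]
  · rintro ⟨w, rfl⟩
    obtain ⟨⟨x, hx⟩, rfl⟩ := Submodule.Quotient.mk_surjective _ w
    rw [hg, connecting_mk, Cohomology.mk_eq_zero_iff]
    simpa using h.exists_D_eq_sub (y := 0) hx.1
      (by rw [LinearMap.mem_ker.1 hx.2, map_zero])

theorem exact_connecting_left (h : IsSplitShortExact P' Q' P Q P'' Q'' D' D D'' i p s r)
    (f : Cohomology Q' P' D' →ₗ[K] Cohomology Q P D)
    (hf : ∀ y hy, f (Submodule.Quotient.mk ⟨y, hy⟩) =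
      Submodule.Quotient.mk ⟨i y, h.swap.i_mem_cocycles.2 hy⟩) :
    Function.Exact h.connecting f := by
  intro z
  constructor
  · obtain ⟨⟨y, hy⟩, rfl⟩ := Submodule.Quotient.mk_surjective _ z
    rw [hf, Cohomology.mk_eq_zero_iff]
    rintro ⟨x, hx, hxy⟩
    have hc : p x ∈ P'' ⊓ LinearMap.ker D'' := by
      refine Submodule.mem_inf.2 ⟨h.p_mem_P x hx, ?_⟩
      rw [LinearMap.mem_ker, h.comm_p, hxy, h.p_i]
    refine ⟨Submodule.Quotient.mk ⟨p x, hc⟩, ?_⟩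
    rw [connecting_mk, Cohomology.mk_eq_mk_iff]
    exact h.exists_D_eq_sub hx hxy
  · rintro ⟨w, rfl⟩
    obtain ⟨⟨c, hc⟩, rfl⟩ := Submodule.Quotient.mk_surjective _ w
    rw [connecting_mk, hf, Cohomology.mk_eq_zero_iff]
    exact ⟨s c, h.s_mem_P c hc.1, (h.i_r_D_s hc.2).symm⟩

end IsSplitShortExact

section Completion

variable {C : ℕ → Type} [∀ n, AddCommGroup (C n)] [∀ n, Module ℝ (C n)]
  {δ : ∀ n, C n →ₗ[ℝ] C (n + 1)} {η : ∀ n, C n →ₗ[ℝ] C (n + 3)}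

theorem Dlin_Dlin (hδδ : ∀ n (x : C n), δ (n + 1) (δ n x) = 0)
    (hδη : ∀ n (x : C n), δ (n + 3) (η n x) = - η (n + 1) (δ n x))
    (hηη : ∀ n (x : C n), η (n + 3) (η n x) = 0) (c : ∀ n, C n) :
    Dlin C δ η (Dlin C δ η c) = 0 := by
  funext n
  match n with
  | 0 => rfl
  | 1 => exact map_zero (δ 0)
  | 2 => exact hδδ 0 _
  | 3 =>
    show δ 2 (δ 1 (c 1)) + η 0 0 = 0
    rw [hδδ 1, map_zero, add_zero]
  | 4 =>
    show δ 3 (δ 2 (c 2) + η 0 (c 0)) + η 1 (δ 0 (c 0)) = 0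
    rw [map_add, hδδ 2, hδη 0, zero_add, neg_add_cancel]
  | 5 =>
    show δ 4 (δ 3 (c 3) + η 1 (c 1)) + η 2 (δ 1 (c 1)) = 0
    rw [map_add, hδδ 3, hδη 1, zero_add, neg_add_cancel]
  | (m + 6) =>
    show δ (m + 5) (δ (m + 4) (c (m + 4)) + η (m + 2) (c (m + 2)))
      + η (m + 3) (δ (m + 2) (c (m + 2)) + η m (c m)) = 0
    rw [map_add, map_add, hδδ (m + 4), hδη (m + 2), hηη m, zero_add, add_zero, neg_add_cancel]

theorem Dlin_mem_oddSub (c : ∀ n, C n) (hc : c ∈ evenSub C) : Dlin C δ η c ∈ oddSub C := by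
  intro n hn
  match n with
  | 0 => rfl
  | 1 => exact absurd hn (by decide)
  | 2 =>
    show δ 1 (c 1) = 0
    rw [hc 1 (by decide), map_zero]
  | (m + 3) =>
    show δ (m + 2) (c (m + 2)) + η m (c m) = 0
    rw [hc (m + 2) (by grind), hc m (by grind), map_zero, map_zero, add_zero]

theorem Dlin_mem_evenSub (c : ∀ n, C n) (hc : c ∈ oddSub C) : Dlin C δ η c ∈ evenSub C := by
  intro n hn
  match n with
  | 0 => rfl
  | 1 =>
    show δ 0 (c 0) = 0
    rw [hc 0 (by decide), map_zero]
  | 2 => exact absurd hn (by decide)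
  | (m + 3) =>
    show δ (m + 2) (c (m + 2)) + η m (c m) = 0
    rw [hc (m + 2) (by grind), hc m (by grind), map_zero, map_zero, add_zero]

variable {C' : ℕ → Type} [∀ n, AddCommGroup (C' n)] [∀ n, Module ℝ (C' n)]
  (φ : ∀ n, C n →ₗ[ℝ] C' n)

theorem piMapL_mem_evenSub (c : ∀ n, C n) (hc : c ∈ evenSub C) :
    piMapL C C' φ c ∈ evenSub C' := fun n hn =>
  (congrArg (φ n) (hc n hn)).trans (map_zero _)

theorem piMapL_mem_oddSub (c : ∀ n, C n) (hc : c ∈ oddSub C) :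
    piMapL C C' φ c ∈ oddSub C' := fun n hn =>
  (congrArg (φ n) (hc n hn)).trans (map_zero _)

theorem piMapL_mem_evenSub_iff (hφ : ∀ n, Function.Injective (φ n)) (c : ∀ n, C n) :
    piMapL C C' φ c ∈ evenSub C' ↔ c ∈ evenSub C :=
  ⟨fun h n hn => hφ n ((h n hn).trans (map_zero _).symm), piMapL_mem_evenSub φ c⟩

theorem piMapL_mem_oddSub_iff (hφ : ∀ n, Function.Injective (φ n)) (c : ∀ n, C n) :
    piMapL C C' φ c ∈ oddSub C' ↔ c ∈ oddSub C :=
  ⟨fun h n hn => hφ n ((h n hn).trans (map_zero _).symm), piMapL_mem_oddSub φ c⟩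

end Completion

/-- The six-term exact sequence in twisted cohomology (used throughout Sections 2 and 3
of the paper): a short exact sequence `0 → C' → C → C'' → 0` of twisted complexes
induces connecting homomorphisms `∂⁰ : H^{ev}(C'') → H^{odd}(C')` and
`∂¹ : H^{odd}(C'') → H^{ev}(C')` making the six-term sequence
`H^{ev}(C') → H^{ev}(C) → H^{ev}(C'') → H^{odd}(C') → H^{odd}(C) → H^{odd}(C'') → H^{ev}(C')`
exact at each of the six terms. -/
theorem six_term_exact_sequence
    (C' C C'' : ℕ → Type)
    [∀ n, AddCommGroup (C' n)] [∀ n, Module ℝ (C' n)]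
    [∀ n, AddCommGroup (C n)] [∀ n, Module ℝ (C n)]
    [∀ n, AddCommGroup (C'' n)] [∀ n, Module ℝ (C'' n)]
    (δ' : ∀ n, C' n →ₗ[ℝ] C' (n + 1)) (η' : ∀ n, C' n →ₗ[ℝ] C' (n + 3))
    (hδδ' : ∀ n (x : C' n), δ' (n + 1) (δ' n x) = 0)
    (hδη' : ∀ n (x : C' n), δ' (n + 3) (η' n x) = - η' (n + 1) (δ' n x))
    (hηη' : ∀ n (x : C' n), η' (n + 3) (η' n x) = 0)
    (δ : ∀ n, C n →ₗ[ℝ] C (n + 1)) (η : ∀ n, C n →ₗ[ℝ] C (n + 3))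
    (hδδ : ∀ n (x : C n), δ (n + 1) (δ n x) = 0)
    (hδη : ∀ n (x : C n), δ (n + 3) (η n x) = - η (n + 1) (δ n x))
    (hηη : ∀ n (x : C n), η (n + 3) (η n x) = 0)
    (δ'' : ∀ n, C'' n →ₗ[ℝ] C'' (n + 1)) (η'' : ∀ n, C'' n →ₗ[ℝ] C'' (n + 3))
    (hδδ'' : ∀ n (x : C'' n), δ'' (n + 1) (δ'' n x) = 0)
    (hδη'' : ∀ n (x : C'' n), δ'' (n + 3) (η'' n x) = - η'' (n + 1) (δ'' n x))
    (hηη'' : ∀ n (x : C'' n), η'' (n + 3) (η'' n x) = 0)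
    -- the chain maps `ι : C' → C` and `π : C → C''`, commuting with `δ` and `η`
    (ι : ∀ n, C' n →ₗ[ℝ] C n) (π : ∀ n, C n →ₗ[ℝ] C'' n)
    (hιδ : ∀ n (x : C' n), ι (n + 1) (δ' n x) = δ n (ι n x))
    (hιη : ∀ n (x : C' n), ι (n + 3) (η' n x) = η n (ι n x))
    (hπδ : ∀ n (x : C n), π (n + 1) (δ n x) = δ'' n (π n x))
    (hπη : ∀ n (x : C n), π (n + 3) (η n x) = η'' n (π n x))
    -- short exactness: `ι` injective, `π` surjective, `ker π = im ι`
    (hιinj : ∀ n, Function.Injective (ι n))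
    (hπsurj : ∀ n, Function.Surjective (π n))
    (hexact : ∀ n (x : C n), π n x = 0 ↔ ∃ y : C' n, ι n y = x) :
    ∃ (d0 : Hev C'' δ'' η'' →ₗ[ℝ] Hodd C' δ' η')
      (d1 : Hodd C'' δ'' η'' →ₗ[ℝ] Hev C' δ' η'),
      Function.Exact ⇑d1 ⇑(inducedEv C' C δ' η' δ η ι hιδ hιη) ∧
      Function.Exact ⇑(inducedEv C' C δ' η' δ η ι hιδ hιη)
        ⇑(inducedEv C C'' δ η δ'' η'' π hπδ hπη) ∧
      Function.Exact ⇑(inducedEv C C'' δ η δ'' η'' π hπδ hπη) ⇑d0 ∧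
      Function.Exact ⇑d0 ⇑(inducedOdd C' C δ' η' δ η ι hιδ hιη) ∧
      Function.Exact ⇑(inducedOdd C' C δ' η' δ η ι hιδ hιη)
        ⇑(inducedOdd C C'' δ η δ'' η'' π hπδ hπη) ∧
      Function.Exact ⇑(inducedOdd C C'' δ η δ'' η'' π hπδ hπη) ⇑d1 := by
  choose s hs using fun n => (π n).exists_rightInverse_of_surjective
    (LinearMap.range_eq_top.2 (hπsurj n))
  choose r hr using fun n => (ι n).exists_leftInverse_of_injective
    (LinearMap.ker_eq_bot.2 (hιinj n))
  have h : IsSplitShortExact (evenSub C') (oddSub C') (evenSub C) (oddSub C)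
      (evenSub C'') (oddSub C'') (Dlin C' δ' η') (Dlin C δ η) (Dlin C'' δ'' η'')
      (piMapL C' C ι) (piMapL C C'' π) (piMapL C'' C s) (piMapL C C' r) :=
    { comm_i := piMapL_comm C' C δ' η' δ η ι hιδ hιη
      comm_p := piMapL_comm C C'' δ η δ'' η'' π hπδ hπη
      exact := fun x => by
        constructor
        · intro hx
          choose y hy using fun n => (hexact n (x n)).1 (congrFun hx n)
          exact ⟨y, funext hy⟩
        · rintro ⟨y, rfl⟩
          exact funext fun n => (hexact n _).2 ⟨y n, rfl⟩
      p_s := fun c => funext fun n => LinearMap.congr_fun (hs n) (c n)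
      r_i := fun y => funext fun n => LinearMap.congr_fun (hr n) (y n)
      D_D := Dlin_Dlin hδδ hδη hηη
      D_mem_Q := Dlin_mem_oddSub
      D_mem_P := Dlin_mem_evenSub
      i_mem_P := piMapL_mem_evenSub_iff ι hιinj
      i_mem_Q := piMapL_mem_oddSub_iff ι hιinj
      p_mem_P := piMapL_mem_evenSub π
      p_mem_Q := piMapL_mem_oddSub π
      s_mem_P := piMapL_mem_evenSub s
      s_mem_Q := piMapL_mem_oddSub s }
  exact ⟨h.connecting, h.swap.connecting,
    h.swap.exact_connecting_left _ fun _ _ => rfl,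
    h.exact_middle _ _ (fun _ _ => rfl) fun _ _ => rfl,
    h.exact_connecting_right _ fun _ _ => rfl,
    h.exact_connecting_left _ fun _ _ => rfl,
    h.swap.exact_middle _ _ (fun _ _ => rfl) fun _ _ => rfl,
    h.swap.exact_connecting_right _ fun _ _ => rfl⟩

end TwistedSES
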